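/- (Concentration of empirical probability estimates in ℓ₂.) Let S be a finite nonempty type, let p be a probability mass function on S, let n ≥ 1, and let X₁, …, Xₙ be i.i.d. S-valued random variables each distributed according to p (for instance, the coordinate maps on the product probability space (S^n, p^{⊗n})). Let P̂ⁿ : S → ℝ be the empirical distribution, P̂ⁿ(s) = (1/n) · #{i ∈ [n] : X_i = s}. Then for every ε > 1/√n, the probability that (∑_{s ∈ S} (P̂ⁿ(s) − p(s))²)^{1/2} > ε is at most exp(−n(ε − 1/√n)²). -/

import Mathlib

open MeasureTheory Finset

lemma aux_hoeffding {S : Type*} [Fintype S] [MeasurableSpace S] [MeasurableSingletonClass S]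
    (p : PMF S) (g : S → ℝ) (c : ℝ) (hg : ∀ s s', g s - g s' ≤ c) :
    ∑ s, (p s).toReal * Real.exp (g s) ≤
      Real.exp (c ^ 2 / 8 + ∑ s, (p s).toReal * g s) := by
  classical
  obtain ⟨s0, hs0⟩ := p.support_nonempty
  obtain ⟨m, -, hm⟩ := Finset.exists_min_image univ g ⟨s0, mem_univ _⟩
  have hI : ∀ᵐ s ∂p.toMeasure, g s ∈ Set.Icc (g m) (g m + c) :=
    Filter.Eventually.of_forall fun s => ⟨hm s (mem_univ _), by linarith [hg s m]⟩
  have h := ProbabilityTheory.hasSubgaussianMGF_of_mem_Icc (μ := p.toMeasure) (X := g)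
    (measurable_of_finite g).aemeasurable hI
  have h1 := h.mgf_le 1
  rw [ProbabilityTheory.mgf, PMF.integral_eq_sum, PMF.integral_eq_sum] at h1
  simp only [smul_eq_mul, one_mul] at h1
  have e : ∀ x, (p x).toReal * Real.exp (g x - ∑ s, (p s).toReal * g s)
      = (p x).toReal * Real.exp (g x) * Real.exp (- ∑ s, (p s).toReal * g s) := by
    intro x; rw [sub_eq_add_neg, Real.exp_add]; ring
  simp only [e, ← Finset.sum_mul] at h1
  rw [Real.exp_neg, ← div_eq_mul_inv, div_le_iff₀ (Real.exp_pos _), ← Real.exp_add] at h1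
  refine h1.trans (Real.exp_le_exp.2 ?_)
  push_cast
  simp
  rw [div_pow, sq_abs]; linarith

lemma aux_sum_cons {S : Type*} [Fintype S] (w : S → ℝ) (n : ℕ) (f : (Fin (n+1) → S) → ℝ) :
    ∑ ω : Fin (n+1) → S, (∏ i, w (ω i)) * f ω =
      ∑ s, w s * ∑ ω : Fin n → S, (∏ i, w (ω i)) * f (Fin.cons s ω) := by
  rw [← (Fin.consEquiv (fun _ : Fin (n+1) => S)).sum_comp, Fintype.sum_prod_type]
  refine Finset.sum_congr rfl fun s _ => ?_
  rw [Finset.mul_sum]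
  refine Finset.sum_congr rfl fun ω _ => ?_
  simp [Fin.consEquiv, Fin.prod_univ_succ, mul_assoc]

lemma aux_sum_one {S : Type*} [Fintype S] (w : S → ℝ) (hw : ∑ s, w s = 1) (n : ℕ) :
    ∑ ω : Fin n → S, ∏ i, w (ω i) = 1 := by
  classical
  have := Finset.prod_univ_sum (fun _ : Fin n => (univ : Finset S)) (fun _ s => w s)
  simp only [Fintype.piFinset_univ] at this
  rw [← this, hw]; simp

lemma aux_mcd {S : Type*} [Fintype S] [MeasurableSpace S] [MeasurableSingletonClass S]
    (p : PMF S) (hp : ∑ s, (p s).toReal = 1) (c : ℝ) (n : ℕ) : ∀ (f : (Fin n → S) → ℝ)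
    (_ : ∀ ω ω' i, (∀ j, j ≠ i → ω j = ω' j) → f ω - f ω' ≤ c),
    ∑ ω : Fin n → S, (∏ i, (p (ω i)).toReal) * Real.exp (f ω) ≤
      Real.exp (n * (c ^ 2 / 8) + ∑ ω : Fin n → S, (∏ i, (p (ω i)).toReal) * f ω) := by
  induction n with
  | zero => intro f _; simp
  | succ n ih =>
    intro f hf
    rw [aux_sum_cons (fun s => (p s).toReal) n (fun ω => Real.exp (f ω)),
      aux_sum_cons (fun s => (p s).toReal) n f]
    have h1 : ∀ s, ∑ ω : Fin n → S, (∏ i, (p (ω i)).toReal) * Real.exp (f (Fin.cons s ω)) ≤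
      Real.exp (n * (c ^ 2 / 8)
        + ∑ ω : Fin n → S, (∏ i, (p (ω i)).toReal) * f (Fin.cons s ω)) := by
      intro s
      refine ih (fun ω => f (Fin.cons s ω)) fun ω ω' i h => hf _ _ i.succ fun j => ?_
      refine Fin.cases (by simp) (fun j hj => ?_) j
      simpa using h j (fun e => hj (by rw [e]))
    have h2 := aux_hoeffding p
      (fun s => ∑ ω : Fin n → S, (∏ i, (p (ω i)).toReal) * f (Fin.cons s ω)) c (by
        intro s s'
        rw [← Finset.sum_sub_distrib]
        calc _ ≤ ∑ ω : Fin n → S, (∏ i, (p (ω i)).toReal) * c := by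
              refine Finset.sum_le_sum fun ω _ => ?_
              rw [← mul_sub]
              refine mul_le_mul_of_nonneg_left (hf _ _ 0 fun j => ?_)
                (Finset.prod_nonneg fun _ _ => ENNReal.toReal_nonneg)
              refine Fin.cases (by simp) (fun j hj => ?_) j
              simp
          _ = c := by rw [← Finset.sum_mul, aux_sum_one _ hp, one_mul])
    calc _ ≤ ∑ s, (p s).toReal * Real.exp (n * (c ^ 2 / 8)
        + ∑ ω : Fin n → S, (∏ i, (p (ω i)).toReal) * f (Fin.cons s ω)) :=
          Finset.sum_le_sum fun s _ => mul_le_mul_of_nonneg_left (h1 s) ENNReal.toReal_nonneg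
      _ = Real.exp (n * (c ^ 2 / 8)) * ∑ s, (p s).toReal * Real.exp (
        ∑ ω : Fin n → S, (∏ i, (p (ω i)).toReal) * f (Fin.cons s ω)) := by
          rw [Finset.mul_sum]
          refine Finset.sum_congr rfl fun s _ => ?_
          rw [Real.exp_add]; ring
      _ ≤ _ := by
          refine (mul_le_mul_of_nonneg_left h2 (Real.exp_pos _).le).trans ?_
          rw [← Real.exp_add]
          refine Real.exp_le_exp.2 ?_
          push_cast
          linarith

lemma aux_var {S : Type*} [Fintype S] (w : S → ℝ) (hw : ∑ s, w s = 1) (h : S → ℝ)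
    (hh : ∑ s, w s * h s = 0) (n : ℕ) : ∀ a : ℝ,
    ∑ ω : Fin n → S, (∏ i, w (ω i)) * (a + ∑ i, h (ω i)) ^ 2
      = a ^ 2 + n * ∑ s, w s * h s ^ 2 := by
  induction n with
  | zero => intro a; simp
  | succ n ih =>
    intro a
    rw [aux_sum_cons w n (fun ω => (a + ∑ i, h (ω i)) ^ 2)]
    simp only [Fin.sum_univ_succ, Fin.cons_zero, Fin.cons_succ, ← add_assoc, ih]
    have e : ∀ s, w s * ((a + h s) ^ 2 + n * ∑ s, w s * h s ^ 2)
      = (a ^ 2 + n * ∑ s, w s * h s ^ 2) * w s + 2 * a * (w s * h s) + w s * h s ^ 2 := by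
      intro s; ring
    simp only [e, Finset.sum_add_distrib, ← Finset.mul_sum, hw, hh]
    push_cast; ring

theorem empirical_distribution_l2_concentration
    {S : Type*} [Fintype S] [Nonempty S] [MeasurableSpace S] [MeasurableSingletonClass S]
    [DecidableEq S]
    (p : PMF S) (n : ℕ) (hn : 1 ≤ n) (ε : ℝ) (hε : 1 / Real.sqrt n < ε) :
    Measure.pi (fun _ : Fin n => p.toMeasure)
      {ω : Fin n → S |
        ε < Real.sqrt (∑ s : S,
          (((univ.filter fun i : Fin n => ω i = s).card : ℝ) / n - (p s).toReal) ^ 2)}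
      ≤ ENNReal.ofReal (Real.exp (-(n : ℝ) * (ε - 1 / Real.sqrt n) ^ 2)) := by
  classical
  have hp : ∑ s, (p s).toReal = 1 := by
    rw [← ENNReal.toReal_sum (fun s _ => p.apply_ne_top s), ← tsum_fintype (L := .unconditional _),
      p.tsum_coe, ENNReal.toReal_one]
  have hn0 : (0 : ℝ) < n := by exact_mod_cast hn
  set D : (Fin n → S) → S → ℝ := fun ω s =>
    ((univ.filter fun i : Fin n => ω i = s).card : ℝ) / n - (p s).toReal with hD
  have hD' : ∀ ω s, D ω s = (1 / n) * ∑ i, ((if ω i = s then (1:ℝ) else 0) - (p s).toReal) := by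
    intro ω s
    simp only [hD, Finset.sum_sub_distrib, Finset.sum_boole]
    simp
    field_simp
  set F : (Fin n → S) → ℝ := fun ω => Real.sqrt (∑ s, D ω s ^ 2) with hF
  set W : (Fin n → S) → ℝ := fun ω => ∏ i, (p (ω i)).toReal with hW
  have hW0 : ∀ ω, 0 ≤ W ω := fun ω => Finset.prod_nonneg fun _ _ => ENNReal.toReal_nonneg
  have hW1 : ∑ ω, W ω = 1 := aux_sum_one _ hp n
  have hFn : ∀ ω, F ω = ‖(WithLp.toLp 2 (D ω) : EuclideanSpace ℝ S)‖ := by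
    intro ω
    simp [EuclideanSpace.norm_eq, hF]
  -- bounded differences
  have hdiff : ∀ ω ω' i, (∀ j, j ≠ i → ω j = ω' j) → F ω - F ω' ≤ Real.sqrt 2 / n := by
    intro ω ω' i h
    rw [hFn, hFn]
    refine (norm_sub_norm_le _ _).trans ?_
    rw [EuclideanSpace.norm_eq]
    have e : ∀ s, D ω s - D ω' s
        = (1 / n) * ((if ω i = s then (1:ℝ) else 0) - (if ω' i = s then (1:ℝ) else 0)) := by
      intro s
      rw [hD', hD', ← mul_sub, ← Finset.sum_sub_distrib, Finset.sum_eq_single i]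
      · ring
      · intro j _ hj; rw [h j hj]; ring
      · simp
    have e2 : ∑ s, (D ω s - D ω' s) ^ 2 ≤ 2 / n ^ 2 := by
      calc _ ≤ ∑ s, (1 / (n:ℝ) ^ 2) *
            ((if ω i = s then (1:ℝ) else 0) + (if ω' i = s then (1:ℝ) else 0)) := by
            refine Finset.sum_le_sum fun s _ => ?_
            rw [e, mul_pow, div_pow, one_pow]
            refine mul_le_mul_of_nonneg_left ?_ (by positivity)
            split_ifs <;> norm_num
        _ = _ := by
            rw [← Finset.mul_sum, Finset.sum_add_distrib]; simp; ring
    rw [show Real.sqrt 2 / n = Real.sqrt (2 / n ^ 2) by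
      rw [Real.sqrt_div (by norm_num), Real.sqrt_sq hn0.le]]
    refine Real.sqrt_le_sqrt ?_
    simpa using e2
  -- mean
  have hsec : ∑ ω, W ω * F ω ^ 2 ≤ 1 / n := by
    have e : ∀ ω, W ω * F ω ^ 2 = ∑ s, (1 / (n:ℝ) ^ 2) * (W ω *
        (0 + ∑ i, ((if ω i = s then (1:ℝ) else 0) - (p s).toReal)) ^ 2) := by
      intro ω
      simp only [hF]
      rw [Real.sq_sqrt (Finset.sum_nonneg fun _ _ => sq_nonneg _), Finset.mul_sum]
      refine Finset.sum_congr rfl fun s _ => ?_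
      rw [hD']; ring
    simp only [e]
    rw [Finset.sum_comm]
    simp only [← Finset.mul_sum]
    have v : ∀ s, ∑ ω, (W ω *
        (0 + ∑ i, ((if ω i = s then (1:ℝ) else 0) - (p s).toReal)) ^ 2)
        ≤ n * (p s).toReal := by
      intro s
      have h0 : ∑ t, (p t).toReal * ((if t = s then (1:ℝ) else 0) - (p s).toReal) = 0 := by
        simp only [mul_sub, Finset.sum_sub_distrib, ← Finset.sum_mul, hp]
        simp
      have := aux_var (fun s => (p s).toReal) hp
        (fun t => (if t = s then (1:ℝ) else 0) - (p s).toReal) h0 n 0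
      refine this.le.trans ?_
      have h2 : ∑ t, (p t).toReal * ((if t = s then (1:ℝ) else 0) - (p s).toReal) ^ 2
          = (p s).toReal - (p s).toReal ^ 2 := by
        have : ∀ t, (p t).toReal * ((if t = s then (1:ℝ) else 0) - (p s).toReal) ^ 2
          = (if t = s then (p t).toReal * (1 - 2 * (p s).toReal) else 0)
            + (p t).toReal * (p s).toReal ^ 2 := by
          intro t; split_ifs <;> ring
        simp only [this, Finset.sum_add_distrib, ← Finset.sum_mul, hp]
        simp
        ring
      rw [h2]
      nlinarith [sq_nonneg (p s).toReal]
    calc _ ≤ (1 / (n:ℝ) ^ 2) * ∑ s, n * (p s).toReal :=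
          mul_le_mul_of_nonneg_left (Finset.sum_le_sum fun s _ => v s) (by positivity)
      _ = 1 / n := by
          rw [← Finset.mul_sum, hp]; field_simp
  have hmean : ∑ ω, W ω * F ω ≤ 1 / Real.sqrt n := by
    have h1 : (∑ ω, W ω * F ω) ^ 2 ≤ 1 / n := by
      refine le_trans ?_ hsec
      have : 0 ≤ ∑ ω, W ω * (F ω - ∑ ω, W ω * F ω) ^ 2 :=
        Finset.sum_nonneg fun ω _ => mul_nonneg (hW0 ω) (sq_nonneg _)
      generalize hm : ∑ ω, W ω * F ω = m at *
      have e : ∀ ω, W ω * (F ω - m) ^ 2 = W ω * F ω ^ 2 - 2 * m * (W ω * F ω) + m ^ 2 * W ω := by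
        intro ω; ring
      simp only [e, Finset.sum_add_distrib, Finset.sum_sub_distrib, ← Finset.mul_sum, hm, hW1]
        at this
      linarith
    have := Real.le_sqrt_of_sq_le h1
    rwa [Real.sqrt_div zero_le_one, Real.sqrt_one] at this
  set t := ε - 1 / Real.sqrt n with ht
  have ht0 : 0 < t := by rw [ht]; linarith
  set l : ℝ := 2 * n * t with hl
  have hl0 : 0 < l := by positivity
  have hmc := aux_mcd p hp (l * (Real.sqrt 2 / n)) n (fun ω => l * F ω) (by
    intro ω ω' i h
    rw [← mul_sub]
    exact mul_le_mul_of_nonneg_left (hdiff ω ω' i h) hl0.le)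
  have hμ : ∀ ω : Fin n → S, Measure.pi (fun _ : Fin n => p.toMeasure) {ω}
      = ENNReal.ofReal (W ω) := by
    intro ω
    rw [Measure.pi_singleton, hW, ENNReal.ofReal_prod_of_nonneg (fun _ _ => ENNReal.toReal_nonneg)]
    refine Finset.prod_congr rfl fun i _ => ?_
    rw [PMF.toMeasure_apply_singleton _ _ (measurableSet_singleton _),
      ENNReal.ofReal_toReal (p.apply_ne_top _)]
  have hset : {ω : Fin n → S | ε < F ω} = ((univ.filter fun ω => ε < F ω : Finset _) : Set _) := by
    ext; simp
  change Measure.pi (fun _ : Fin n => p.toMeasure) {ω : Fin n → S | ε < F ω} ≤ _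
  rw [hset, ← sum_measure_singleton]
  simp only [hμ]
  rw [← ENNReal.ofReal_sum_of_nonneg (fun ω _ => hW0 ω)]
  refine ENNReal.ofReal_le_ofReal ?_
  calc ∑ ω with ε < F ω, W ω ≤ ∑ ω with ε < F ω, W ω * Real.exp (l * F ω) * Real.exp (-(l * ε)) := by
        refine Finset.sum_le_sum fun ω hω => ?_
        rw [mul_assoc, ← Real.exp_add]
        refine le_mul_of_one_le_right (hW0 ω) (Real.one_le_exp ?_)
        have := (Finset.mem_filter.1 hω).2
        nlinarith
    _ ≤ ∑ ω, W ω * Real.exp (l * F ω) * Real.exp (-(l * ε)) :=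
        Finset.sum_le_sum_of_subset_of_nonneg (Finset.filter_subset _ _) fun ω _ _ =>
          mul_nonneg (mul_nonneg (hW0 ω) (Real.exp_pos _).le) (Real.exp_pos _).le
    _ = (∑ ω, W ω * Real.exp (l * F ω)) * Real.exp (-(l * ε)) := by rw [Finset.sum_mul]
    _ ≤ _ := by
        refine (mul_le_mul_of_nonneg_right hmc (Real.exp_pos _).le).trans ?_
        rw [← Real.exp_add]
        refine Real.exp_le_exp.2 ?_
        have e1 : ∑ ω, (∏ i, (p (ω i)).toReal) * (l * F ω) = l * ∑ ω, W ω * F ω := by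
          rw [Finset.mul_sum]
          refine Finset.sum_congr rfl fun ω _ => ?_
          simp only [hW]; ring
        rw [e1, mul_pow, div_pow, Real.sq_sqrt (by norm_num)]
        have e2 : (n:ℝ) * (l ^ 2 * (2 / n ^ 2) / 8) = n * t ^ 2 := by
          rw [hl]; field_simp; ring
        rw [e2]
        have e3 := mul_le_mul_of_nonneg_left hmean hl0.le
        have e4 : l * (1 / Real.sqrt n) - l * ε = - 2 * n * t ^ 2 := by
          rw [← mul_sub, show 1 / Real.sqrt n - ε = -t by rw [ht]; ring, hl]; ring
        linarith
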